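/- arXiv:math-ph/0210027 — 3 statements merged into one kernel-verified Lean document; each statement's English description precedes it below -/
import Mathlib

section
/- Let n be a positive integer. Suppose that for every positive definite Hermitian n×n complex matrix a, every positive semidefinite Hermitian n×n complex matrix b, and every positive integer p, the function λ ↦ Tr((a+λb)^{−p}) on [0,∞) is the Laplace transform of a positive measure supported in [0,∞). Then for all positive semidefinite Hermitian n×n complex matrices A and B and every positive integer p, the polynomial λ ↦ Tr((A+λB)^p) has only non-negative coefficients. -/
open MeasureTheory Matrix
open scoped ComplexOrder

/-- `f` is the Laplace transform of a (finite) positive Borel measure supported in `[0, ∞)`. -/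
def IsLaplaceTransform (f : ℝ → ℂ) : Prop :=
  ∃ μ : Measure ℝ, IsFiniteMeasure μ ∧ μ (Set.Iio 0) = 0 ∧
    ∀ l : ℝ, 0 ≤ l → f l = ∫ t, (Real.exp (-l * t) : ℂ) ∂μ

/-- For a Hermitian matrix `M`, the matrix `M ^ q` (real exponent), defined via the
functional calculus (junk value `0` if `M` is not Hermitian). -/
noncomputable def matRpow {n : ℕ} (M : Matrix (Fin n) (Fin n) ℂ) (q : ℝ) :
    Matrix (Fin n) (Fin n) ℂ :=
  if hM : M.IsHermitian then
    (hM.eigenvectorUnitary : Matrix (Fin n) (Fin n) ℂ) *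
      Matrix.diagonal (fun i => ((hM.eigenvalues i ^ q : ℝ) : ℂ)) *
      star (hM.eigenvectorUnitary : Matrix (Fin n) (Fin n) ℂ)
  else 0

/-- The polynomial `λ ↦ Tr((A + λ B) ^ p)`. -/
noncomputable def tracePoly {n : ℕ} (A B : Matrix (Fin n) (Fin n) ℂ) (p : ℕ) : Polynomial ℂ :=
  ((A.map Polynomial.C + (Polynomial.X : Polynomial ℂ) • B.map Polynomial.C) ^ p).trace


open Polynomial in
/-- The matrix-coefficient polynomial `A + X B`. -/
noncomputable def linPoly {n : ℕ} (A B : Matrix (Fin n) (Fin n) ℂ) :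
    Polynomial (Matrix (Fin n) (Fin n) ℂ) := C A + X * C B

/-- Sum of all words with `q` letters `A` and `k` letters `B` ending in `A`. -/
noncomputable def wordSum {n : ℕ} (A B : Matrix (Fin n) (Fin n) ℂ) :
    ℕ → ℕ → Matrix (Fin n) (Fin n) ℂ
  | 0, 0 => 1
  | 0, _ + 1 => 0
  | q + 1, 0 => A * wordSum A B q 0
  | q + 1, k + 1 => A * wordSum A B q (k + 1) + B * wordSum A B (q + 1) k

section algebra
variable {n : ℕ} (A B : Matrix (Fin n) (Fin n) ℂ)

lemma wordSum_succ_succ (q k : ℕ) : wordSum A B (q + 1) (k + 1) =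
    A * wordSum A B q (k + 1) + B * wordSum A B (q + 1) k := by
  rw [wordSum]

lemma tracePoly_coeff (p k : ℕ) :
    (tracePoly A B p).coeff k = ((linPoly A B ^ p).coeff k).trace := by
  have h : matPolyEquiv (A.map Polynomial.C + (Polynomial.X : Polynomial ℂ) • B.map Polynomial.C)
      = linPoly A B := by
    rw [map_add, matPolyEquiv_map_smul, matPolyEquiv_map_C, matPolyEquiv_map_C, linPoly]
    simp
  rw [← h, ← map_pow, tracePoly, Matrix.trace, Matrix.trace, Polynomial.finsetSum_coeff]
  simp only [Matrix.diag_apply, matPolyEquiv_coeff_apply]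

lemma linPoly_succ_zero (p : ℕ) :
    (linPoly A B ^ (p + 1)).coeff 0 = A * (linPoly A B ^ p).coeff 0 := by
  rw [pow_succ', linPoly, add_mul, Polynomial.coeff_add, Polynomial.coeff_C_mul, mul_assoc,
    Polynomial.coeff_X_mul_zero, add_zero]

lemma linPoly_succ_succ (p k : ℕ) :
    (linPoly A B ^ (p + 1)).coeff (k + 1) =
      A * (linPoly A B ^ p).coeff (k + 1) + B * (linPoly A B ^ p).coeff k := by
  rw [pow_succ', linPoly, add_mul, Polynomial.coeff_add, Polynomial.coeff_C_mul, mul_assoc,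
    Polynomial.coeff_X_mul, Polynomial.coeff_C_mul]

lemma linPoly_lt (p k : ℕ) (hk : p < k) : (linPoly A B ^ p).coeff k = 0 := by
  induction p generalizing k with
  | zero => simp [Polynomial.coeff_one]; omega
  | succ p ih =>
    obtain ⟨k, rfl⟩ : ∃ j, k = j + 1 := ⟨k - 1, by omega⟩
    rw [linPoly_succ_succ, ih _ (by omega), ih _ (by omega)]; simp

lemma linPoly_self (p : ℕ) : (linPoly A B ^ p).coeff p = B ^ p := by
  induction p with
  | zero => simp
  | succ p ih => rw [linPoly_succ_succ, ih, linPoly_lt _ _ _ _ (by omega), pow_succ']; simp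

lemma wordSum_eq (q k : ℕ) : wordSum A B (q + 1) k = (linPoly A B ^ (q + k)).coeff k * A := by
  induction q generalizing k with
  | zero =>
    induction k with
    | zero => simp [wordSum]
    | succ k ih =>
      rw [wordSum, ih, ← add_assoc, linPoly_succ_succ, wordSum,
        linPoly_lt A B (0 + k) (k + 1) (by omega)]
      simp [mul_assoc]
  | succ q ihq =>
    induction k with
    | zero => rw [wordSum, ihq, add_zero, add_zero, linPoly_succ_zero, mul_assoc]
    | succ k ih =>
      rw [wordSum_succ_succ, ih, ihq, ← add_assoc (q + 1) k 1, linPoly_succ_succ, add_mul, mul_assoc,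
        mul_assoc, show q + (k + 1) = q + 1 + k by ring]

lemma trace_coeff_mul_comm (P Q : Polynomial (Matrix (Fin n) (Fin n) ℂ)) (k : ℕ) :
    ((P * Q).coeff k).trace = ((Q * P).coeff k).trace := by
  rw [Polynomial.coeff_mul, Polynomial.coeff_mul, Matrix.trace_sum, Matrix.trace_sum,
    ← Finset.Nat.sum_antidiagonal_swap]
  exact Finset.sum_congr rfl fun x _ => Matrix.trace_mul_comm _ _

lemma trace_coeff_derivative_pow (P : Polynomial (Matrix (Fin n) (Fin n) ℂ)) (m j k : ℕ) :
    ((P ^ j * Polynomial.derivative (P ^ (m + 1))).coeff k).trace =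
      (m + 1) * ((P ^ (j + m) * Polynomial.derivative P).coeff k).trace := by
  induction m generalizing j with
  | zero => simp
  | succ m ih =>
    rw [pow_succ P (m + 1), Polynomial.derivative_mul, mul_add, Polynomial.coeff_add,
      Matrix.trace_add, ← mul_assoc, trace_coeff_mul_comm, ← mul_assoc, ← pow_succ', ih,
      ← mul_assoc, ← pow_add, show j + 1 + m = j + (m + 1) by ring]
    push_cast; ring

lemma trace_coeff_B (m k : ℕ) :
    (k + 1) * ((linPoly A B ^ (m + 1)).coeff (k + 1)).trace =
      (m + 1) * (B * (linPoly A B ^ m).coeff k).trace := by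
  have h := trace_coeff_derivative_pow (linPoly A B) m 0 k
  have hd : Polynomial.derivative (linPoly A B) = Polynomial.C B := by
    simp [linPoly]
  rw [hd, Polynomial.coeff_mul_C, pow_zero, one_mul, zero_add, Polynomial.coeff_derivative,
    Matrix.trace_mul_comm _ B] at h
  rw [← h]
  have : ((k : Matrix (Fin n) (Fin n) ℂ) + 1) = ((k : ℂ) + 1) • 1 := by
    rw [add_smul, one_smul, Nat.cast_smul_eq_nsmul, nsmul_one]
  rw [this]
  simp

/-- The coefficient identity. -/
lemma trace_wordSum (q k : ℕ) :
    ((q + 1 + k : ℕ) : ℂ) * (wordSum A B (q + 1) k).trace =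
      (q + 1) * ((linPoly A B ^ (q + 1 + k)).coeff k).trace := by
  rw [wordSum_eq, Matrix.trace_mul_comm]
  cases k with
  | zero => rw [add_zero, add_zero, linPoly_succ_zero]; push_cast; ring
  | succ k =>
    have h1 := trace_coeff_B A B (q + (k + 1)) k
    have h2 := congrArg Matrix.trace (linPoly_succ_succ A B (q + (k + 1)) k)
    rw [Matrix.trace_add] at h2
    rw [show q + 1 + (k + 1) = q + (k + 1) + 1 by ring]
    push_cast at *
    linear_combination h1 - (q + (k + 1) + 1 : ℂ) * h2

end algebra

section analysis

lemma nonneg_of_real_mul (r : ℝ) (hr : 0 < r) (z : ℂ) (h : 0 ≤ (r : ℂ) * z) : 0 ≤ z := by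
  rw [Complex.nonneg_iff] at *
  simp only [Complex.re_ofReal_mul, Complex.im_ofReal_mul] at h
  refine ⟨nonneg_of_mul_nonneg_right h.1 hr, ?_⟩
  rcases mul_eq_zero.1 h.2.symm with h | h
  · exact absurd h hr.ne'
  · exact h.symm

variable {n : ℕ} (A B : Matrix (Fin n) (Fin n) ℂ)

lemma one_add_posDef (hB : B.PosSemidef) (l : ℝ) (hl : 0 ≤ l) : (1 + l • B).PosDef :=
  Matrix.PosDef.one.add_posSemidef (hB.smul hl)

lemma continuousAt_res : ContinuousAt (fun l : ℝ => (1 + l • B)⁻¹) 0 := by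
  have h1 : ContinuousAt (fun M : Matrix (Fin n) (Fin n) ℂ => M⁻¹) (1 + (0 : ℝ) • B) := by
    apply continuousAt_matrix_inv
    simp only [Ring.inverse_eq_inv']
    apply continuousAt_inv₀
    simp
  exact ContinuousAt.comp (f := fun l : ℝ => 1 + l • B) h1 (by fun_prop)

lemma expansion (hB : B.PosSemidef) (K q : ℕ) :
    ∃ R : ℝ → Matrix (Fin n) (Fin n) ℂ, ContinuousAt R 0 ∧ ∀ l : ℝ, 0 ≤ l →
      ((1 + l • B)⁻¹ * A) ^ q =
        ∑ j ∈ Finset.range (K + 1), (-l) ^ j • wordSum A B q j + l ^ (K + 1) • R l := by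
  induction q with
  | zero =>
    refine ⟨fun _ => 0, continuousAt_const, fun l _ => ?_⟩
    rw [Finset.sum_range_succ']
    simp [wordSum]
  | succ q ih =>
    obtain ⟨R, hR, h⟩ := ih
    refine ⟨fun l => (1 + l • B)⁻¹ * (A * R l + (-1 : ℝ) ^ (K + 1 + 1) •
      (-1 : ℝ) • (B * wordSum A B (q + 1) K)), ?_, fun l hl => ?_⟩
    · have := continuousAt_res B
      fun_prop
    · have hu : IsUnit (1 + l • B).det :=
        (Matrix.isUnit_iff_isUnit_det _).1 (one_add_posDef B hB l hl).isUnit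
      have key : ∀ K : ℕ, (1 + l • B) * ∑ j ∈ Finset.range (K + 1),
          (-l) ^ j • wordSum A B (q + 1) j =
          A * ∑ j ∈ Finset.range (K + 1), (-l) ^ j • wordSum A B q j
            - (-l) ^ (K + 1) • (B * wordSum A B (q + 1) K) := by
        intro K
        induction K with
        | zero => simp [wordSum, add_mul]
        | succ K ihK =>
          rw [Finset.sum_range_succ, mul_add, ihK, Finset.sum_range_succ _ (K + 1), wordSum_succ_succ]
          simp only [mul_add, add_mul, one_mul, smul_mul_assoc, mul_smul_comm, smul_add, smul_smul]
          simp only [pow_succ]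
          module
      have e : ∑ j ∈ Finset.range (K + 1), (-l) ^ j • wordSum A B (q + 1) j =
          (1 + l • B)⁻¹ * (A * ∑ j ∈ Finset.range (K + 1), (-l) ^ j • wordSum A B q j
            - (-l) ^ (K + 1) • (B * wordSum A B (q + 1) K)) := by
        rw [← key, ← mul_assoc, Matrix.nonsing_inv_mul _ hu, one_mul]
      rw [e, pow_succ', h l hl, mul_assoc]
      beta_reduce
      rw [← mul_smul_comm (l ^ (K + 1)) ((1 + l • B)⁻¹), ← mul_add ((1 + l • B)⁻¹)]
      congr 1
      simp only [mul_add, smul_add, mul_smul_comm, neg_pow l]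
      simp only [pow_succ]
      module

lemma alt_sum_pow (k j : ℕ) (hj : j ≤ k) :
    ∑ i ∈ Finset.range (k + 1), ((-1 : ℂ) ^ i * (k.choose i)) * (i : ℂ) ^ j =
      if j = k then (-1) ^ k * (k.factorial : ℂ) else 0 := by
  have h := fwdDiff_iter_eq_sum_shift (1 : ℂ) (fun r : ℂ => r ^ j) k 0
  have h2 : (fwdDiff (1 : ℂ))^[k] (fun r : ℂ => r ^ j) 0 = if j = k then (k.factorial : ℂ) else 0 := by
    split_ifs with hjk
    · subst hjk; rw [fwdDiff_iter_eq_factorial]; rfl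
    · rw [fwdDiff_iter_pow_eq_zero_of_lt (lt_of_le_of_ne hj hjk)]; rfl
  have h3 : (if j = k then (-1) ^ k * (k.factorial : ℂ) else 0) =
    (-1) ^ k * (if j = k then (k.factorial : ℂ) else 0) := by split_ifs <;> simp
  rw [h3, ← h2, h, Finset.mul_sum]
  refine Finset.sum_congr rfl fun i hi => ?_
  have hi' : i ≤ k := by simpa [Nat.lt_succ_iff] using hi
  obtain ⟨d, rfl⟩ := Nat.exists_eq_add_of_le hi'
  have : ((-1 : ℂ) ^ d) * (-1) ^ d = 1 := by rw [← mul_pow]; simp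
  simp only [Nat.add_sub_cancel_left, zsmul_eq_mul, zero_add, nsmul_eq_mul, mul_one, pow_add]
  push_cast
  linear_combination (-(-1 : ℂ) ^ i * ((i + d).choose i) * (i : ℂ) ^ j) * this

lemma laplace_diff_nonneg (f : ℝ → ℂ) (hf : IsLaplaceTransform f) (k : ℕ) (h : ℝ) (hh : 0 ≤ h) :
    0 ≤ ∑ i ∈ Finset.range (k + 1), ((-1 : ℂ) ^ i * (k.choose i)) * f (i * h) := by
  obtain ⟨μ, hμ, h0, hf⟩ := hf
  have hae : ∀ᵐ t ∂μ, 0 ≤ t := by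
    rw [ae_iff]; convert h0 using 2; ext; simp
  have hint : ∀ i : ℕ, Integrable (fun t : ℝ => ((Real.exp (-(i * h) * t) : ℝ) : ℂ)) μ := by
    intro i
    refine Integrable.of_bound (by fun_prop) 1 ?_
    filter_upwards [hae] with t ht
    rw [Complex.norm_real, Real.norm_eq_abs, abs_of_pos (Real.exp_pos _), Real.exp_le_one_iff]
    have : 0 ≤ (i * h) * t := by positivity
    linarith
  have e : ∑ i ∈ Finset.range (k + 1), ((-1 : ℂ) ^ i * (k.choose i)) * f (i * h) =
      ∫ t, (((1 - Real.exp (-h * t)) ^ k : ℝ) : ℂ) ∂μ := by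
    calc _ = ∑ i ∈ Finset.range (k + 1), ∫ t, ((-1 : ℂ) ^ i * (k.choose i)) *
          ((Real.exp (-(i * h) * t) : ℝ) : ℂ) ∂μ := by
          refine Finset.sum_congr rfl fun i _ => ?_
          rw [integral_const_mul, hf _ (by positivity)]
      _ = ∫ t, ∑ i ∈ Finset.range (k + 1), ((-1 : ℂ) ^ i * (k.choose i)) *
          ((Real.exp (-(i * h) * t) : ℝ) : ℂ) ∂μ := by
          rw [integral_finsetSum]
          intro i _
          exact (hint i).const_mul _
      _ = _ := by
          congr 1
          ext t
          rw [sub_eq_neg_add, add_pow]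
          push_cast
          refine Finset.sum_congr rfl fun i _ => ?_
          rw [one_pow, mul_one, neg_pow (Complex.exp _), ← Complex.exp_nat_mul,
            show -((i : ℂ) * h) * t = i * (-h * t) by ring]
          ring
  rw [e, integral_complex_ofReal]
  rw [Complex.zero_le_real]
  refine integral_nonneg_of_ae ?_
  filter_upwards [hae] with t ht
  have : Real.exp (-h * t) ≤ 1 := by
    rw [Real.exp_le_one_iff]
    have : 0 ≤ h * t := by positivity
    linarith
  exact pow_nonneg (by linarith) _

lemma laplace_coeff_nonneg (f : ℝ → ℂ) (hf : IsLaplaceTransform f) (k : ℕ) (c : ℕ → ℂ)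
    (g : ℝ → ℂ) (hg : ContinuousAt g 0)
    (hfg : ∀ l : ℝ, 0 ≤ l → f l = ∑ j ∈ Finset.range (k + 1), (-(l : ℂ)) ^ j * c j
      + (l : ℂ) ^ (k + 1) * g l) : 0 ≤ c k := by
  set G : ℝ → ℂ := fun h => ∑ i ∈ Finset.range (k + 1), ((-1 : ℂ) ^ i * (k.choose i)) *
    ((i : ℂ) ^ (k + 1) * g (i * h)) with hG
  have hGc : ContinuousAt G 0 := by
    refine tendsto_finsetSum _ fun i _ => ?_
    have : ContinuousAt (fun h : ℝ => g (i * h)) 0 :=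
      ContinuousAt.comp (f := fun h : ℝ => (i : ℝ) * h) (by simpa using hg) (by fun_prop)
    exact (this.const_mul _).const_mul _
  have hid : ∀ h : ℝ, 0 ≤ h → ∑ i ∈ Finset.range (k + 1), ((-1 : ℂ) ^ i * (k.choose i)) * f (i * h)
      = (h : ℂ) ^ k * (k.factorial * c k + h * G h) := by
    intro h hh
    have h1 : ∑ i ∈ Finset.range (k + 1), ((-1 : ℂ) ^ i * (k.choose i)) * f (i * h) =
        ∑ i ∈ Finset.range (k + 1), ∑ j ∈ Finset.range (k + 1),
          ((-(h : ℂ)) ^ j * c j) * (((-1 : ℂ) ^ i * (k.choose i)) * (i : ℂ) ^ j) +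
          (h : ℂ) ^ (k + 1) * G h := by
      rw [hG, Finset.mul_sum, ← Finset.sum_add_distrib]
      refine Finset.sum_congr rfl fun i _ => ?_
      rw [hfg _ (by positivity), mul_add, Finset.mul_sum]
      congr 1
      · refine Finset.sum_congr rfl fun j _ => ?_
        push_cast
        rw [show -((i : ℂ) * h) = i * (-h) by ring, mul_pow]
        ring
      · push_cast
        rw [mul_pow]; ring
    rw [h1, Finset.sum_comm]
    have h2 : ∀ j ∈ Finset.range (k + 1), ∑ i ∈ Finset.range (k + 1),
        ((-(h : ℂ)) ^ j * c j) * (((-1 : ℂ) ^ i * (k.choose i)) * (i : ℂ) ^ j) =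
        if j = k then (h : ℂ) ^ k * (k.factorial * c k) else 0 := by
      intro j hj
      rw [← Finset.mul_sum, alt_sum_pow k j (by simpa [Nat.lt_succ_iff] using hj)]
      split_ifs with hjk
      · subst hjk
        have : ((-1 : ℂ) ^ j) * (-1) ^ j = 1 := by rw [← mul_pow]; simp
        rw [neg_pow]
        linear_combination ((h : ℂ) ^ j * c j * j.factorial) * this
      · simp
    rw [Finset.sum_congr rfl h2]
    simp
    ring
  have hpos : ∀ h : ℝ, 0 < h → 0 ≤ (k.factorial * c k + h * G h : ℂ) := by
    intro h hh
    have := laplace_diff_nonneg f hf k h hh.le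
    rw [hid h hh.le] at this
    exact nonneg_of_real_mul (h ^ k) (by positivity) _ (by push_cast; exact this)
  have hlim : Filter.Tendsto (fun h : ℝ => (k.factorial * c k + h * G h : ℂ))
      (nhdsWithin 0 (Set.Ioi 0)) (nhds (k.factorial * c k + (0 : ℝ) * G 0)) := by
    have : ContinuousAt (fun h : ℝ => (k.factorial * c k + h * G h : ℂ)) 0 := by fun_prop
    exact this.tendsto.mono_left nhdsWithin_le_nhds
  have := ge_of_tendsto hlim (by filter_upwards [self_mem_nhdsWithin] with h hh using hpos h hh)
  simp only [Complex.ofReal_zero, zero_mul, add_zero] at this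
  exact nonneg_of_real_mul k.factorial (by positivity) _ (by push_cast; exact this)

lemma continuous_linPoly_coeff (p k : ℕ) :
    Continuous fun e : ℝ => (linPoly (A + e • 1) B ^ p).coeff k := by
  induction p generalizing k with
  | zero => simpa using continuous_const
  | succ p ih =>
    cases k with
    | zero => simp only [linPoly_succ_zero]; have := ih 0; fun_prop
    | succ k =>
      simp only [linPoly_succ_succ]
      have := ih k
      have := ih (k + 1)
      fun_prop

end analysis

section main
open scoped MatrixOrder Matrix.Norms.L2Operator
variable {n : ℕ}

lemma posDef_case
    (h : ∀ a b : Matrix (Fin n) (Fin n) ℂ, a.PosDef → b.PosSemidef → ∀ p : ℕ, 0 < p →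
      IsLaplaceTransform fun l : ℝ => (((a + l • b)⁻¹) ^ p).trace)
    (A B : Matrix (Fin n) (Fin n) ℂ) (hA : A.PosDef) (hB : B.PosSemidef) (q k : ℕ) :
    0 ≤ ((linPoly A B ^ (q + 1 + k)).coeff k).trace := by
  obtain ⟨Y, hY⟩ : ∃ Y : Matrix (Fin n) (Fin n) ℂ, A = Y * Yᴴ := by
    obtain ⟨Z, hZ⟩ := CStarAlgebra.nonneg_iff_eq_star_mul_self.1 hA.posSemidef.nonneg
    rw [Matrix.star_eq_conjTranspose] at hZ
    exact ⟨Zᴴ, by simpa using hZ⟩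
  have hYu : IsUnit Y.det := by
    have := (Matrix.isUnit_iff_isUnit_det _).1 hA.isUnit
    rw [hY, Matrix.det_mul] at this
    exact isUnit_of_mul_isUnit_left this
  have hYu' : IsUnit Yᴴ.det := by
    rw [Matrix.det_conjTranspose]; exact hYu.star
  have hb : (Y⁻¹ * B * (Y⁻¹)ᴴ).PosSemidef := hB.mul_mul_conjTranspose_same _
  have ha : (Y⁻¹ * (Y⁻¹)ᴴ).PosDef := by
    refine (Matrix.posSemidef_self_mul_conjTranspose _).posDef_iff_isUnit.2 ?_
    rw [Matrix.conjTranspose_nonsing_inv]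
    refine IsUnit.mul ?_ ?_
    · exact (Matrix.isUnit_nonsing_inv_iff).2 ((Matrix.isUnit_iff_isUnit_det _).2 hYu)
    · exact (Matrix.isUnit_nonsing_inv_iff).2 ((Matrix.isUnit_iff_isUnit_det _).2 hYu')
  have hL := h _ _ ha hb (q + 1) (Nat.succ_pos _)
  obtain ⟨R, hR, hexp⟩ := expansion A B hB k (q + 1)
  have hw : 0 ≤ (wordSum A B (q + 1) k).trace := by
    refine laplace_coeff_nonneg _ hL k (fun j => (wordSum A B (q + 1) j).trace)
      (fun l => (R l).trace) (by fun_prop) fun l hl => ?_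
    have e1 : (Y⁻¹ * (Y⁻¹)ᴴ + l • (Y⁻¹ * B * (Y⁻¹)ᴴ))⁻¹ =
        Yᴴ * ((1 + l • B)⁻¹ * A) * (Yᴴ)⁻¹ := by
      have : Y⁻¹ * (Y⁻¹)ᴴ + l • (Y⁻¹ * B * (Y⁻¹)ᴴ) = Y⁻¹ * (1 + l • B) * (Yᴴ)⁻¹ := by
        rw [Matrix.conjTranspose_nonsing_inv, mul_add, add_mul, mul_one]
        simp
      rw [this, Matrix.mul_inv_rev, Matrix.mul_inv_rev, Matrix.nonsing_inv_nonsing_inv _ hYu,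
        Matrix.nonsing_inv_nonsing_inv _ hYu', hY]
      simp only [mul_assoc]
      rw [Matrix.mul_nonsing_inv _ hYu', mul_one]
    have e2 : ∀ (M : Matrix (Fin n) (Fin n) ℂ) (m : ℕ),
        (Yᴴ * M * (Yᴴ)⁻¹) ^ m = Yᴴ * M ^ m * (Yᴴ)⁻¹ := by
      intro M m
      induction m with
      | zero => simp [Matrix.mul_nonsing_inv _ hYu']
      | succ m ih =>
        rw [pow_succ, ih, pow_succ]
        calc _ = Yᴴ * M ^ m * ((Yᴴ)⁻¹ * Yᴴ) * M * (Yᴴ)⁻¹ := by simp only [mul_assoc]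
          _ = _ := by rw [Matrix.nonsing_inv_mul _ hYu']; simp only [mul_assoc, mul_one, one_mul]
    beta_reduce
    rw [e1, e2, Matrix.trace_mul_comm, ← mul_assoc, Matrix.nonsing_inv_mul _ hYu', one_mul,
      hexp l hl, Matrix.trace_add, Matrix.trace_sum]
    simp only [Matrix.trace_smul, Complex.real_smul]
    push_cast
    rfl
  have ht := trace_wordSum A B q k
  refine nonneg_of_real_mul (q + 1) (by positivity) _ ?_
  push_cast
  rw [← ht]
  exact mul_nonneg (by exact_mod_cast Nat.zero_le _) hw

end main

theorem neg_pow_laplace_implies_coeff_nonneg (n : ℕ) (hn : 0 < n)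
    (h : ∀ a b : Matrix (Fin n) (Fin n) ℂ, a.PosDef → b.PosSemidef → ∀ p : ℕ, 0 < p →
      IsLaplaceTransform fun l : ℝ => (((a + l • b)⁻¹) ^ p).trace) :
    ∀ A B : Matrix (Fin n) (Fin n) ℂ, A.PosSemidef → B.PosSemidef → ∀ p : ℕ, 0 < p →
      ∀ k : ℕ, 0 ≤ (tracePoly A B p).coeff k := by
  intro A B hA hB p hp k
  rw [tracePoly_coeff]
  rcases lt_trichotomy p k with hk | rfl | hk
  · rw [linPoly_lt _ _ _ _ hk]; simp
  · rw [linPoly_self]; exact (hB.pow _).trace_nonneg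
  · obtain ⟨q, rfl⟩ : ∃ q, p = q + 1 + k := ⟨p - k - 1, by omega⟩
    have hc : Continuous fun e : ℝ => ((linPoly (A + e • 1) B ^ (q + 1 + k)).coeff k).trace :=
      (continuous_linPoly_coeff A B (q + 1 + k) k).matrix_trace
    have hlim := (hc.tendsto 0).mono_left (nhdsWithin_le_nhds (s := Set.Ioi 0))
    have := ge_of_tendsto hlim (b := 0) (by
      filter_upwards [self_mem_nhdsWithin] with e he
      exact posDef_case h _ B (Matrix.PosDef.posSemidef_add hA (Matrix.PosDef.one.smul he)) hB q k)
    simpa using this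
end

section
/- Let n be a positive integer and suppose that for all positive semidefinite Hermitian n×n complex matrices A and B and every positive integer p, the polynomial λ ↦ Tr((A+λB)^p) has only non-negative coefficients. Then for all positive semidefinite Hermitian n×n complex matrices A and B, and for every function f : [0,∞) → ℝ that is the Laplace transform of a positive measure supported in [0,∞), the function λ ↦ Tr(f(A+λB)) on [0,∞) is the Laplace transform of a positive measure supported in [0,∞). -/
open MeasureTheory Matrix
open scoped ComplexOrder

/-- `f : ℝ → ℝ` is the Laplace transform of a (finite) positive Borel measure supported
in `[0, ∞)`. -/
def IsLaplaceTransformReal (f : ℝ → ℝ) : Prop :=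
  ∃ μ : Measure ℝ, IsFiniteMeasure μ ∧ μ (Set.Iio 0) = 0 ∧
    ∀ l : ℝ, 0 ≤ l → f l = ∫ t, Real.exp (-l * t) ∂μ

/-- Application of a real function `f` to a Hermitian matrix `M` by the functional
calculus (junk value `0` if `M` is not Hermitian). -/
noncomputable def matFun {n : ℕ} (M : Matrix (Fin n) (Fin n) ℂ) (f : ℝ → ℝ) :
    Matrix (Fin n) (Fin n) ℂ :=
  if hM : M.IsHermitian then
    (hM.eigenvectorUnitary : Matrix (Fin n) (Fin n) ℂ) *
      Matrix.diagonal (fun i => ((f (hM.eigenvalues i) : ℝ) : ℂ)) *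
      star (hM.eigenvectorUnitary : Matrix (Fin n) (Fin n) ℂ)
  else 0


open Filter Topology in
lemma exists_approx_measure (N : ℕ) (hN : 0 < N) (F : ℝ → ℝ) (c : ℕ → ℝ) (hc : ∀ j, 0 ≤ c j)
    (H : ∀ l : ℝ, 0 ≤ l → l ≤ N → HasSum (fun j => c j * (1 - l / N) ^ j) (F l)) :
    ∃ ν : FiniteMeasure unitInterval, ν.mass = (F 0).toNNReal ∧
      ∀ l : ℝ, 0 ≤ l → l ≤ N →
        |∫ x : unitInterval, (x : ℝ) ^ l ∂(ν : Measure unitInterval) - F l| ≤ F 0 * (l / N) := by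
  have hN' : (0 : ℝ) < N := by exact_mod_cast hN
  have h0 : HasSum c (F 0) := by simpa using H 0 le_rfl hN'.le
  have hF0 : 0 ≤ F 0 := h0.nonneg hc
  let pt : ℕ → unitInterval := fun j =>
    ⟨Real.exp (-(j / N : ℝ)), (Real.exp_pos _).le, Real.exp_le_one_iff.2 (by
      have : (0 : ℝ) ≤ j / N := by positivity
      linarith)⟩
  let m : Measure unitInterval :=
    Measure.sum fun j => ENNReal.ofReal (c j) • Measure.dirac (pt j)
  have hm : m Set.univ = ENNReal.ofReal (F 0) := by
    simp only [m, Measure.sum_apply _ MeasurableSet.univ, Measure.smul_apply,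
      Measure.dirac_apply' _ MeasurableSet.univ]
    simp only [Set.indicator_univ, Pi.one_apply, smul_eq_mul, mul_one]
    rw [← ENNReal.ofReal_tsum_of_nonneg hc h0.summable, h0.tsum_eq]
  have hfin : IsFiniteMeasure m := ⟨by rw [hm]; exact ENNReal.ofReal_lt_top⟩
  refine ⟨⟨m, hfin⟩, ?_, ?_⟩
  · change (m Set.univ).toNNReal = _
    rw [hm]; rfl
  · intro l hl hlN
    change |∫ x : unitInterval, (x : ℝ) ^ l ∂m - F l| ≤ F 0 * (l / N)
    have hcont : Continuous fun x : unitInterval => (x : ℝ) ^ l :=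
      (Real.continuous_rpow_const hl).comp continuous_subtype_val
    have hint : Integrable (fun x : unitInterval => (x : ℝ) ^ l) m :=
      hcont.integrable_of_hasCompactSupport (HasCompactSupport.of_compactSpace _)
    have hs := hasSum_integral_measure hint
    have hs2 : HasSum (fun j => c j * Real.exp (-(j * (l / N)))) (∫ x : unitInterval, (x : ℝ) ^ l ∂m) := by
      refine hs.congr_fun ?_ |> fun h => h
      intro j
      rw [integral_smul_measure, integral_dirac, ENNReal.toReal_ofReal (hc j), smul_eq_mul]
      simp only [pt]
      rw [← Real.exp_mul]
      congr 2
      ring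
    have hu0 : 0 ≤ l / N := by positivity
    have hu1 : l / N ≤ 1 := (div_le_one hN').2 hlN
    set u := l / N with hu
    have key : ∀ j : ℕ, 0 ≤ Real.exp (-(j * u)) - (1 - u) ^ j ∧
        Real.exp (-(j * u)) - (1 - u) ^ j ≤ u := by
      intro j
      have e1 : Real.exp (-(j * u)) = Real.exp (-u) ^ j := by
        rw [← Real.exp_nat_mul]; congr 1; ring
      constructor
      · rw [e1, sub_nonneg]
        exact pow_le_pow_left₀ (by linarith) (Real.one_sub_le_exp_neg u) j
      · have b1 : 1 - u ^ 2 ≤ (1 - u) * Real.exp u := by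
          nlinarith [Real.add_one_le_exp u]
        have b2 : (1 - u ^ 2) ^ j ≤ ((1 - u) * Real.exp u) ^ j :=
          pow_le_pow_left₀ (by nlinarith) b1 j
        have b3 : 1 + (j : ℝ) * (-u ^ 2) ≤ (1 + (-u ^ 2)) ^ j :=
          one_add_mul_le_pow (by nlinarith) j
        have b4 : 1 - j * u ^ 2 ≤ (1 - u) ^ j * Real.exp (j * u) := by
          rw [Real.exp_nat_mul, ← mul_pow]
          calc 1 - j * u ^ 2 = 1 + (j : ℝ) * (-u ^ 2) := by ring
            _ ≤ (1 + (-u ^ 2)) ^ j := b3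
            _ = (1 - u ^ 2) ^ j := by ring
            _ ≤ _ := b2
        have b5 : (j * u) * Real.exp (-(j * u)) ≤ 1 := by
          rw [Real.exp_neg, ← div_eq_mul_inv, div_le_one (Real.exp_pos _)]
          linarith [Real.add_one_le_exp (j * u)]
        have b6 := mul_le_mul_of_nonneg_right b4 (Real.exp_pos (-(j * u))).le
        rw [mul_assoc, ← Real.exp_add, add_neg_cancel, Real.exp_zero, mul_one] at b6
        nlinarith
    have hd := hs2.sub (H l hl hlN)
    have hb := h0.mul_right u
    rw [abs_of_nonneg]
    · refine hasSum_le (fun j => ?_) hd hb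
      rw [← mul_sub]
      exact mul_le_mul_of_nonneg_left (key j).2 (hc j)
    · refine hd.nonneg fun j => ?_
      rw [← mul_sub]
      exact mul_nonneg (hc j) (key j).1

open Filter Topology in
lemma bernstein_aux (F : ℝ → ℝ)
    (H : ∀ N : ℕ, 0 < N → ∃ c : ℕ → ℝ, (∀ j, 0 ≤ c j) ∧
      ∀ l : ℝ, 0 ≤ l → l ≤ N → HasSum (fun j => c j * (1 - l / N) ^ j) (F l)) :
    ∃ μ : Measure ℝ, IsFiniteMeasure μ ∧ μ (Set.Iio 0) = 0 ∧
      ∀ l : ℝ, 0 ≤ l → F l = ∫ t, Real.exp (-l * t) ∂μ := by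
  choose c hc hH using H
  -- right continuity at zero along `1/(k+1)`
  have hcont : Tendsto (fun k : ℕ => F (1 / ((k : ℝ) + 1))) atTop (𝓝 (F 0)) := by
    have h1 := hH 1 one_pos
    have hcO : ContinuousOn (fun l : ℝ => ∑' j, c 1 one_pos j * (1 - l / (1 : ℕ)) ^ j)
        (Set.Icc 0 1) := by
      refine continuousOn_tsum (u := c 1 one_pos) (fun i => by fun_prop) ?_ ?_
      · simpa using (h1 0 le_rfl (by simp)).summable
      · intro j x hx
        rw [norm_mul, Real.norm_of_nonneg (hc 1 one_pos j), norm_pow]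
        refine mul_le_of_le_one_right (hc 1 one_pos j) (pow_le_one₀ (norm_nonneg _) ?_)
        rw [Real.norm_eq_abs, abs_le]
        simp only [Nat.cast_one, div_one]
        constructor <;> linarith [hx.1, hx.2]
    have hcF : ContinuousOn F (Set.Icc 0 1) :=
      hcO.congr fun l hl => (h1 l hl.1 (by simpa using hl.2)).tsum_eq.symm
    refine (hcF 0 (by simp)).tendsto.comp (tendsto_nhdsWithin_iff.2
      ⟨tendsto_one_div_add_atTop_nhds_zero_nat, Eventually.of_forall fun k => ?_⟩)
    refine ⟨by positivity, ?_⟩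
    rw [div_le_one (by positivity)]
    linarith [(Nat.cast_nonneg k : (0 : ℝ) ≤ k)]
  have hF0 : 0 ≤ F 0 := ((hH 1 one_pos) 0 le_rfl (by simp)).nonneg
    fun j => mul_nonneg (hc _ _ j) (by simp)
  have hA : ∀ k : ℕ, ∃ ν : FiniteMeasure unitInterval, ν.mass = (F 0).toNNReal ∧
      ∀ l : ℝ, 0 ≤ l → l ≤ (k + 1 : ℕ) →
        |∫ x : unitInterval, (x : ℝ) ^ l ∂(ν : Measure unitInterval) - F l|
          ≤ F 0 * (l / (k + 1 : ℕ)) := fun k =>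
    exists_approx_measure (k + 1) k.succ_pos F _ (hc _ k.succ_pos) (hH _ k.succ_pos)
  choose ν hmass hν using hA
  let U : Ultrafilter ℕ := hyperfilter ℕ
  have hU : (U : Filter ℕ) ≤ atTop := Nat.hyperfilter_le_atTop
  obtain ⟨ν₀, hν₀, hlim⟩ := (isCompact_setOfPred_finiteMeasure_eq_of_compactSpace unitInterval
    (F 0).toNNReal).ultrafilter_le_nhds' (U.map ν) (by
      rw [Ultrafilter.mem_map]
      exact Filter.univ_mem' hmass)
  have hlim' : Tendsto ν U (𝓝 ν₀) := hlim
  have hrep : ∀ l : ℝ, 0 ≤ l → ∫ x : unitInterval, (x : ℝ) ^ l ∂(ν₀ : Measure unitInterval) = F l := by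
    intro l hl
    have hcl : Continuous fun x : unitInterval => (x : ℝ) ^ l :=
      (Real.continuous_rpow_const hl).comp continuous_subtype_val
    have t1 := (FiniteMeasure.tendsto_iff_forall_integral_tendsto.1 hlim')
      (BoundedContinuousFunction.mkOfCompact ⟨_, hcl⟩)
    simp only [BoundedContinuousFunction.mkOfCompact_apply, ContinuousMap.coe_mk] at t1
    have t2 : Tendsto (fun k => ∫ x : unitInterval, (x : ℝ) ^ l ∂(ν k : Measure unitInterval)) atTop
        (𝓝 (F l)) := by
      rw [tendsto_iff_dist_tendsto_zero]
      have t3 : Tendsto (fun k : ℕ => F 0 * (l / (k + 1 : ℕ))) atTop (𝓝 0) := by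
        have := ((tendsto_const_div_atTop_nhds_zero_nat l).comp (tendsto_add_atTop_nat 1)).const_mul
          (F 0)
        simpa using this
      refine squeeze_zero' (Eventually.of_forall fun k => dist_nonneg) ?_ t3
      filter_upwards [eventually_ge_atTop ⌈l⌉₊] with k hk
      rw [Real.dist_eq]
      refine hν k l hl ?_
      calc l ≤ ⌈l⌉₊ := Nat.le_ceil l
        _ ≤ (k + 1 : ℕ) := by exact_mod_cast hk.trans (Nat.le_succ k)
    exact tendsto_nhds_unique t1 (t2.mono_left hU)
  -- no mass at zero
  have hz : ∀ᵐ x : unitInterval ∂(ν₀ : Measure unitInterval), (x : ℝ) ≠ 0 := by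
    have d : Tendsto (fun k : ℕ => ∫ x : unitInterval, (x : ℝ) ^ (1 / ((k : ℝ) + 1))
        ∂(ν₀ : Measure unitInterval)) atTop
        (𝓝 (∫ x : unitInterval, ({x : unitInterval | (x : ℝ) ≠ 0}.indicator 1 x : ℝ)
          ∂(ν₀ : Measure unitInterval))) := by
      refine tendsto_integral_of_dominated_convergence (fun _ => 1) (fun k => ?_)
        (integrable_const _) (fun k => ?_) ?_
      · exact ((Real.continuous_rpow_const (by positivity)).comp
          continuous_subtype_val).aestronglyMeasurable
      · refine Eventually.of_forall fun x => ?_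
        rw [Real.norm_of_nonneg (Real.rpow_nonneg x.2.1 _)]
        exact Real.rpow_le_one x.2.1 x.2.2 (by positivity)
      · refine Eventually.of_forall fun x => ?_
        by_cases hx : (x : ℝ) = 0
        · have : ∀ k : ℕ, (x : ℝ) ^ (1 / ((k : ℝ) + 1)) = 0 := fun k => by
            rw [hx, Real.zero_rpow (by positivity)]
          simp only [this]
          rw [Set.indicator_of_notMem (show x ∉ {x : unitInterval | (x : ℝ) ≠ 0} from fun h => h hx)]
          exact tendsto_const_nhds
        · have : Tendsto (fun k : ℕ => (x : ℝ) ^ (1 / ((k : ℝ) + 1))) atTop (𝓝 ((x : ℝ) ^ (0 : ℝ))) :=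
            tendsto_const_nhds.rpow tendsto_one_div_add_atTop_nhds_zero_nat (Or.inl hx)
          rw [Set.indicator_of_mem (show x ∈ {x : unitInterval | (x : ℝ) ≠ 0} from hx)]
          simpa using this
    have hms : MeasurableSet {x : unitInterval | (x : ℝ) ≠ 0} :=
      (isOpen_ne_fun continuous_subtype_val continuous_const).measurableSet
    have e : (ν₀ : Measure unitInterval).real {x : unitInterval | (x : ℝ) ≠ 0}
        = (ν₀ : Measure unitInterval).real Set.univ := by
      rw [integral_indicator_one hms] at d
      have d2 : Tendsto (fun k : ℕ => ∫ x : unitInterval, (x : ℝ) ^ (1 / ((k : ℝ) + 1))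
          ∂(ν₀ : Measure unitInterval)) atTop (𝓝 (F 0)) := by
        refine hcont.congr fun k => (hrep _ (by positivity)).symm
      rw [tendsto_nhds_unique d d2, ← hrep 0 le_rfl]
      simp
    have e2 := measureReal_compl (μ := (ν₀ : Measure unitInterval)) hms
    rw [e, sub_self, measureReal_eq_zero_iff] at e2
    exact e2
  have hmeas : Measurable fun x : unitInterval => -Real.log (x : ℝ) := by fun_prop
  refine ⟨(ν₀ : Measure unitInterval).map fun x : unitInterval => -Real.log (x : ℝ), inferInstance, ?_, ?_⟩
  · rw [Measure.map_apply hmeas measurableSet_Iio]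
    convert measure_empty (μ := (ν₀ : Measure unitInterval))
    ext x
    simp only [Set.mem_preimage, Set.mem_Iio, Set.mem_empty_iff_false, iff_false, not_lt,
      Left.nonneg_neg_iff]
    exact Real.log_nonpos x.2.1 x.2.2
  · intro l hl
    rw [integral_map hmeas.aemeasurable (by fun_prop), ← hrep l hl]
    refine integral_congr_ae ?_
    filter_upwards [hz] with x hx
    rw [Real.rpow_def_of_pos (lt_of_le_of_ne x.2.1 (Ne.symm hx))]
    congr 1
    ring

lemma laplace_series (f : ℝ → ℝ) (hf : IsLaplaceTransformReal f) (a : ℝ) (ha : 0 ≤ a) :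
    ∃ w : ℕ → ℝ, (∀ p, 0 ≤ w p) ∧ ∀ x : ℝ, 0 ≤ x → x ≤ a →
      HasSum (fun p => w p * (a - x) ^ p) (f x) := by
  obtain ⟨μ, hμ, h0, hfl⟩ := hf
  have hpos : ∀ᵐ t ∂μ, 0 ≤ t := by
    rw [ae_iff]
    convert h0 using 2
    ext t; simp
  refine ⟨fun p => ∫ t, Real.exp (-a * t) * (t ^ p / p.factorial) ∂μ, fun p => ?_, ?_⟩
  · refine integral_nonneg_of_ae ?_
    filter_upwards [hpos] with t ht
    exact mul_nonneg (Real.exp_pos _).le (by positivity)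
  · intro x hx hxa
    have hser : ∀ t : ℝ, HasSum (fun p : ℕ => Real.exp (-a * t) * (((a - x) * t) ^ p / p.factorial))
        (Real.exp (-x * t)) := by
      intro t
      have := (NormedSpace.expSeries_div_hasSum_exp ((a - x) * t)).mul_left (Real.exp (-a * t))
      rw [← Real.exp_eq_exp_ℝ] at this
      rw [← Real.exp_add] at this
      rwa [show -a * t + (a - x) * t = -x * t by ring] at this
    have hle : ∀ t, 0 ≤ t → ∀ p : ℕ,
        0 ≤ Real.exp (-a * t) * (((a - x) * t) ^ p / p.factorial) := fun t ht p =>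
      mul_nonneg (Real.exp_pos _).le
        (div_nonneg (pow_nonneg (mul_nonneg (by linarith) ht) _) (by positivity))
    have hint : ∀ p : ℕ, Integrable
        (fun t => Real.exp (-a * t) * (((a - x) * t) ^ p / p.factorial)) μ := by
      intro p
      refine Integrable.mono' (integrable_const (1 : ℝ)) (by fun_prop) ?_
      filter_upwards [hpos] with t ht
      rw [Real.norm_of_nonneg (hle t ht p)]
      refine (le_hasSum (hser t) p fun q _ => hle t ht q).trans ?_
      exact Real.exp_le_one_iff.2 (by nlinarith)
    have hsum := hasSum_integral_of_dominated_convergence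
      (F := fun (p : ℕ) t => Real.exp (-a * t) * (((a - x) * t) ^ p / p.factorial))
      (f := fun t => Real.exp (-x * t)) (μ := μ)
      (fun (p : ℕ) t => Real.exp (-a * t) * (((a - x) * t) ^ p / p.factorial))
      (fun p => (hint p).aestronglyMeasurable)
      (fun p => by
        filter_upwards [hpos] with t ht
        rw [Real.norm_of_nonneg (hle t ht p)])
      (Filter.Eventually.of_forall fun t => (hser t).summable)
      (by
        simp only [fun t => (hser t).tsum_eq]
        refine Integrable.mono' (integrable_const (1 : ℝ)) (by fun_prop) ?_
        filter_upwards [hpos] with t ht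
        rw [Real.norm_of_nonneg (Real.exp_pos _).le]
        exact Real.exp_le_one_iff.2 (by nlinarith))
      (Filter.Eventually.of_forall hser)
    rw [← hfl x hx] at hsum
    refine hsum.congr_fun fun p => ?_
    rw [← integral_mul_const]
    congr 1
    ext t
    rw [mul_pow]; ring

lemma matFun_trace {n : ℕ} {M : Matrix (Fin n) (Fin n) ℂ} (hM : M.IsHermitian) (f : ℝ → ℝ) :
    (matFun M f).trace = ((∑ i, f (hM.eigenvalues i) : ℝ) : ℂ) := by
  rw [matFun, dif_pos hM, Matrix.trace_mul_cycle]
  simp [Matrix.trace_diagonal]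

lemma sub_eq_conj {n : ℕ} {M : Matrix (Fin n) (Fin n) ℂ} (hM : M.IsHermitian) (a : ℝ) :
    (a : ℂ) • (1 : Matrix (Fin n) (Fin n) ℂ) - M =
      Unitary.conjStarAlgAut ℂ _ hM.eigenvectorUnitary
        (Matrix.diagonal fun i => ((a - hM.eigenvalues i : ℝ) : ℂ)) := by
  conv_lhs => rw [hM.spectral_theorem]
  have : (Matrix.diagonal fun i => ((a - hM.eigenvalues i : ℝ) : ℂ)) =
      (a : ℂ) • (1 : Matrix (Fin n) (Fin n) ℂ) -
        Matrix.diagonal (RCLike.ofReal ∘ hM.eigenvalues) := by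
    rw [Matrix.smul_one_eq_diagonal, Matrix.diagonal_sub]
    congr 1
    ext i
    simp
  rw [this, map_sub, map_smul, map_one]

lemma pow_trace {n : ℕ} {M : Matrix (Fin n) (Fin n) ℂ} (hM : M.IsHermitian) (a : ℝ) (p : ℕ) :
    (((a : ℂ) • (1 : Matrix (Fin n) (Fin n) ℂ) - M) ^ p).trace =
      ((∑ i, (a - hM.eigenvalues i) ^ p : ℝ) : ℂ) := by
  rw [sub_eq_conj hM, ← map_pow, Unitary.conjStarAlgAut_apply, Matrix.trace_mul_cycle,
    Matrix.diagonal_pow]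
  simp [Matrix.trace_diagonal]

lemma sub_posSemidef {n : ℕ} {M : Matrix (Fin n) (Fin n) ℂ} (hM : M.IsHermitian) (a : ℝ) :
    ((a : ℂ) • (1 : Matrix (Fin n) (Fin n) ℂ) - M).PosSemidef ↔ ∀ i, hM.eigenvalues i ≤ a := by
  have hd : (Matrix.diagonal fun i => ((a - hM.eigenvalues i : ℝ) : ℂ)).PosSemidef ↔
      ∀ i, hM.eigenvalues i ≤ a := by
    rw [Matrix.posSemidef_diagonal_iff]
    refine forall_congr' fun i => ?_
    rw [Complex.zero_le_real, sub_nonneg]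
  rw [← hd]
  constructor
  · intro h
    have := h.conjTranspose_mul_mul_same (hM.eigenvectorUnitary : Matrix (Fin n) (Fin n) ℂ)
    rw [sub_eq_conj hM, Unitary.conjStarAlgAut_apply] at this
    convert this using 1
    rw [← Matrix.star_eq_conjTranspose]
    simp only [← mul_assoc]
    simp [mul_assoc]
  · intro h
    rw [sub_eq_conj hM, Unitary.conjStarAlgAut_apply, Matrix.star_eq_conjTranspose]
    exact h.mul_mul_conjTranspose_same _

lemma tracePoly_eval {n : ℕ} (A B : Matrix (Fin n) (Fin n) ℂ) (p : ℕ) (z : ℂ) :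
    (tracePoly A B p).eval z = ((A + z • B) ^ p).trace := by
  have h1 : (Polynomial.evalRingHom z).mapMatrix
      (A.map Polynomial.C + (Polynomial.X : Polynomial ℂ) • B.map Polynomial.C) = A + z • B := by
    ext i j
    simp
    exact mul_comm _ _
  rw [← h1, ← map_pow, tracePoly, ← Polynomial.coe_evalRingHom, RingHom.mapMatrix_apply]
  simp [Matrix.trace]

theorem coeff_nonneg_implies_trace_funCalc_laplace (n : ℕ) (hn : 0 < n)
    (h : ∀ A B : Matrix (Fin n) (Fin n) ℂ, A.PosSemidef → B.PosSemidef → ∀ p : ℕ, 0 < p →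
      ∀ k : ℕ, 0 ≤ (tracePoly A B p).coeff k) :
    ∀ A B : Matrix (Fin n) (Fin n) ℂ, A.PosSemidef → B.PosSemidef →
      ∀ f : ℝ → ℝ, IsLaplaceTransformReal f →
        IsLaplaceTransform fun l : ℝ => (matFun (A + l • B) f).trace := by
  intro A B hA hB f hf
  have hps : ∀ l : ℝ, 0 ≤ l → (A + l • B).PosSemidef := fun l hl => hA.add (hB.smul hl)
  have hmain : ∃ μ : Measure ℝ, IsFiniteMeasure μ ∧ μ (Set.Iio 0) = 0 ∧
      ∀ l : ℝ, 0 ≤ l → (matFun (A + l • B) f).trace.re = ∫ t, Real.exp (-l * t) ∂μ := by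
    apply bernstein_aux
    intro N hN
    have hN' : (0 : ℝ) < N := by exact_mod_cast hN
    have hMN := hps N hN'.le
    set a : ℝ := ∑ i, hMN.isHermitian.eigenvalues i with ha
    have ha0 : 0 ≤ a := Finset.sum_nonneg fun i _ => hMN.eigenvalues_nonneg i
    have hA' : ((a : ℂ) • (1 : Matrix (Fin n) (Fin n) ℂ) - (A + (N : ℝ) • B)).PosSemidef :=
      (sub_posSemidef hMN.isHermitian a).2 fun i =>
        Finset.single_le_sum (fun j _ => hMN.eigenvalues_nonneg j) (Finset.mem_univ i)
    set A' := (a : ℂ) • (1 : Matrix (Fin n) (Fin n) ℂ) - (A + (N : ℝ) • B) with hA'def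
    obtain ⟨w, hw, hws⟩ := laplace_series f hf a ha0
    have hcoef : ∀ p k, 0 ≤ (tracePoly A' B p).coeff k := by
      intro p k
      rcases Nat.eq_zero_or_pos p with rfl | hp
      · simp only [tracePoly, pow_zero, Matrix.trace_one, Fintype.card_fin,
          Polynomial.coeff_natCast_ite]
        split_ifs <;> simp
      · exact h A' B hA' hB p hp k
    let q : ℕ → ℕ → ℝ := fun p k => ((tracePoly A' B p).coeff k).re
    have hq : ∀ p k, 0 ≤ q p k := fun p k => (Complex.le_def.1 (hcoef p k)).1
    have hqc : ∀ p k, (tracePoly A' B p).coeff k = (q p k : ℂ) := fun p k =>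
      (Complex.ext rfl (by simpa using (Complex.le_def.1 (hcoef p k)).2.symm))
    refine ⟨fun j => (N : ℝ) ^ j * ∑' p, w p * q p j,
      fun j => mul_nonneg (by positivity) (tsum_nonneg fun p => mul_nonneg (hw p) (hq p j)), ?_⟩
    intro l hl hlN
    have hM := hps l hl
    have hsplit : (a : ℂ) • (1 : Matrix (Fin n) (Fin n) ℂ) - (A + l • B) =
        A' + ((N - l : ℝ) : ℂ) • B := by
      rw [hA'def, Complex.coe_smul (N - l : ℝ) B, sub_smul]
      abel
    have heig : ∀ i, hM.isHermitian.eigenvalues i ≤ a := by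
      rw [← sub_posSemidef, hsplit, Complex.coe_smul]
      exact hA'.add (hB.smul (sub_nonneg.2 hlN))
    -- inner sums
    have hinner : ∀ p, HasSum (fun j => w p * q p j * (N - l) ^ j)
        (w p * ∑ i, (a - hM.isHermitian.eigenvalues i) ^ p) := by
      intro p
      have e : ∑ i, (a - hM.isHermitian.eigenvalues i) ^ p =
          ∑ j ∈ Finset.range ((tracePoly A' B p).natDegree + 1), q p j * (N - l) ^ j := by
        apply Complex.ofReal_injective
        rw [← pow_trace hM.isHermitian, hsplit, ← tracePoly_eval, Polynomial.eval_eq_sum_range]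
        push_cast
        refine Finset.sum_congr rfl fun j _ => ?_
        rw [hqc]
      rw [e]
      simp only [mul_assoc]
      refine HasSum.mul_left _ (hasSum_sum_of_ne_finset_zero fun j hj => ?_)
      have : (tracePoly A' B p).coeff j = 0 :=
        Polynomial.coeff_eq_zero_of_natDegree_lt (by simpa using hj)
      simp [q, this]
    have houter : HasSum (fun p => w p * ∑ i, (a - hM.isHermitian.eigenvalues i) ^ p)
        (matFun (A + l • B) f).trace.re := by
      rw [matFun_trace hM.isHermitian, Complex.ofReal_re]
      simp only [Finset.mul_sum]
      exact hasSum_sum fun i _ => hws _ (hM.eigenvalues_nonneg i) (heig i)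
    have hnn : (0 : ℕ × ℕ → ℝ) ≤ fun x => w x.1 * q x.1 x.2 * (N - l) ^ x.2 := fun x =>
      mul_nonneg (mul_nonneg (hw _) (hq _ _)) (pow_nonneg (sub_nonneg.2 hlN) _)
    have hsm : Summable fun x : ℕ × ℕ => w x.1 * q x.1 x.2 * (N - l) ^ x.2 := by
      rw [summable_prod_of_nonneg hnn]
      refine ⟨fun p => (hinner p).summable, ?_⟩
      simp only [fun p => (hinner p).tsum_eq]
      exact houter.summable
    have hs1 := hsm.hasSum.prod_fiberwise hinner
    have hval := hs1.unique houter
    have hs2 := hsm.prod_symm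
    have hs3 := hs2.hasSum.prod_fiberwise fun j => (hs2.prod_factor j).hasSum
    have hsw : ∑' x : ℕ × ℕ, w x.swap.1 * q x.swap.1 x.swap.2 * ((N : ℝ) - l) ^ x.swap.2
        = ∑' x : ℕ × ℕ, w x.1 * q x.1 x.2 * ((N : ℝ) - l) ^ x.2 :=
      (Equiv.prodComm ℕ ℕ).tsum_eq fun x : ℕ × ℕ => w x.1 * q x.1 x.2 * ((N : ℝ) - l) ^ x.2
    rw [hsw, hval] at hs3
    convert hs3 using 2 with j
    simp only [Prod.swap_prod_mk]
    rw [tsum_mul_right]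
    have : ((N : ℝ) - l) ^ j = N ^ j * (1 - l / N) ^ j := by
      rw [← mul_pow]; congr 1; field_simp
    rw [this]; ring
  obtain ⟨μ, h1, h2, h3⟩ := hmain
  refine ⟨μ, h1, h2, fun l hl => ?_⟩
  have : (matFun (A + l • B) f).trace = ((matFun (A + l • B) f).trace.re : ℂ) := by
    rw [matFun_trace (hps l hl).isHermitian, Complex.ofReal_re]
  simp only
  rw [this, h3 l hl, ← integral_complex_ofReal]
end

section
/- Let n be a positive integer. Suppose that for every positive definite Hermitian n×n complex matrix a, every positive semidefinite Hermitian n×n complex matrix b, and every positive integer p, the function λ ↦ Tr((a+λb)^{−p}) on [0,∞) is the Laplace transform of a positive measure supported in [0,∞). Then the same conclusion holds for every real exponent p > 0: for every positive definite Hermitian a, positive semidefinite Hermitian b, and real p > 0, the function λ ↦ Tr((a+λb)^{−p}) on [0,∞) is the Laplace transform of a positive measure supported in [0,∞). -/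
open MeasureTheory Matrix
open scoped ComplexOrder

open Filter Topology

/-- `f` is the moment function of a finite measure on the unit interval. -/
def IsMom (f : ℝ → ℝ) : Prop :=
  ∃ ν : FiniteMeasure unitInterval, ∀ l : ℝ, 0 ≤ l → f l = ∫ x, (x : ℝ) ^ l ∂(ν : Measure unitInterval)

lemma isMom_congr {f g : ℝ → ℝ} (hf : IsMom f) (hfg : ∀ l, 0 ≤ l → g l = f l) : IsMom g := by
  obtain ⟨ν, hν⟩ := hf
  exact ⟨ν, fun l hl => by rw [hfg l hl, hν l hl]⟩

lemma continuous_mom (l : ℝ) (hl : 0 ≤ l) : Continuous (fun x : unitInterval => (x : ℝ) ^ l) :=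
  continuous_subtype_val.rpow_const (fun _ => Or.inr hl)

lemma integrable_mom (ν : FiniteMeasure unitInterval) (l : ℝ) (hl : 0 ≤ l) :
    Integrable (fun x : unitInterval => (x : ℝ) ^ l) (ν : Measure unitInterval) := by
  have h := (BoundedContinuousFunction.mkOfCompact
    ⟨_, continuous_mom l hl⟩).integrable (ν : Measure unitInterval)
  exact h

lemma isMom_zero : IsMom (fun _ => 0) := ⟨0, fun l _ => by simp⟩

lemma isMom_add {f g : ℝ → ℝ} (hf : IsMom f) (hg : IsMom g) : IsMom (fun l => f l + g l) := by
  obtain ⟨ν, hν⟩ := hf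
  obtain ⟨ρ, hρ⟩ := hg
  refine ⟨ν + ρ, fun l hl => ?_⟩
  rw [FiniteMeasure.toMeasure_add, integral_add_measure (integrable_mom ν l hl)
    (integrable_mom ρ l hl)]
  simp only [hν l hl, hρ l hl]

lemma isMom_smul {f : ℝ → ℝ} (hf : IsMom f) (c : ℝ) (hc : 0 ≤ c) : IsMom (fun l => c * f l) := by
  obtain ⟨ν, hν⟩ := hf
  lift c to NNReal using hc
  refine ⟨c • ν, fun l hl => ?_⟩
  rw [FiniteMeasure.toMeasure_smul, integral_smul_nnreal_measure]
  simp only [hν l hl]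
  rfl

lemma isMom_sum {ι : Type*} (s : Finset ι) (f : ι → ℝ → ℝ) (hf : ∀ i ∈ s, IsMom (f i)) :
    IsMom (fun l => ∑ i ∈ s, f i l) := by
  classical
  induction s using Finset.induction_on with
  | empty => simpa using isMom_zero
  | insert i s hi ih =>
    simp only [Finset.sum_insert hi]
    exact isMom_add (hf i (by simp)) (ih fun j hj => hf j (by simp [hj]))

lemma isMom_lim (f : ℕ → ℝ → ℝ) (g : ℝ → ℝ) (hf : ∀ N, IsMom (f N))
    (h : ∀ l, 0 ≤ l → Tendsto (fun N => f N l) atTop (𝓝 (g l))) : IsMom g := by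
  choose ν hν using hf
  obtain ⟨C, hC⟩ := (h 0 le_rfl).bddAbove_range
  have hmass : ∀ N, (ν N).mass ≤ C.toNNReal := by
    intro N
    have h1 : f N 0 ≤ C := hC ⟨N, rfl⟩
    rw [hν N 0 le_rfl] at h1
    simp only [Real.rpow_zero, integral_const, smul_eq_mul, mul_one] at h1
    apply NNReal.le_toNNReal_of_coe_le
    exact h1
  have hcomp := isCompact_setOfPred_finiteMeasure_le_of_compactSpace (E := unitInterval) C.toNNReal
  obtain ⟨μ, -, hμ⟩ := hcomp.ultrafilter_le_nhds ((hyperfilter ℕ).map ν) (by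
    simp only [le_principal_iff]
    exact Filter.mem_map.2 (Filter.univ_mem' hmass))
  have hμ' : Tendsto ν (hyperfilter ℕ : Filter ℕ) (𝓝 μ) := hμ
  refine ⟨μ, fun l hl => ?_⟩
  rw [FiniteMeasure.tendsto_iff_forall_integral_tendsto] at hμ'
  have h1 := hμ' (BoundedContinuousFunction.mkOfCompact ⟨_, continuous_mom l hl⟩)
  have h2 : Tendsto (fun N => f N l) (hyperfilter ℕ : Filter ℕ) (𝓝 (g l)) :=
    (h l hl).mono_left Nat.hyperfilter_le_atTop
  refine tendsto_nhds_unique h2 ?_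
  simp only [hν _ l hl]
  exact h1

/-- Laplace transforms are moment functions. -/
lemma isMom_of_laplace {f : ℝ → ℂ} (hf : IsLaplaceTransform f) :
    ∃ g : ℝ → ℝ, IsMom g ∧ ∀ l, 0 ≤ l → f l = (g l : ℂ) := by
  obtain ⟨μ, hfin, h0, h⟩ := hf
  let φ : ℝ → unitInterval := fun t => Set.projIcc 0 1 zero_le_one (Real.exp (-t))
  have hφ : Measurable φ := by
    apply Continuous.measurable
    exact continuous_projIcc.comp (by fun_prop)
  refine ⟨fun l => ∫ t, Real.exp (-l * t) ∂μ, ⟨⟨μ.map φ, inferInstance⟩, fun l hl => ?_⟩, ?_⟩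
  · simp only [FiniteMeasure.toMeasure_mk]
    rw [integral_map hφ.aemeasurable (continuous_mom l hl).aestronglyMeasurable]
    apply integral_congr_ae
    have h1 : ∀ᵐ t ∂μ, ¬ t < 0 := by
      rw [ae_iff]; simpa using! h0
    filter_upwards [h1] with t ht
    have : (φ t : ℝ) = Real.exp (-t) := by
      simp only [φ]
      rw [Set.projIcc_of_mem]
      exact ⟨(Real.exp_pos _).le, by simp; linarith⟩
    rw [this, ← Real.exp_mul]
    ring_nf
  · intro l hl
    rw [h l hl]
    exact integral_ofReal

/-- Shifted moment functions are Laplace transforms. -/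
lemma laplace_of_isMom {g : ℝ → ℝ} (hg : IsMom g) (ε : ℝ) (hε : 0 < ε) :
    IsLaplaceTransform (fun l => (g (l + ε) : ℂ)) := by
  obtain ⟨ν, hν⟩ := hg
  let ψ : unitInterval → ℝ := fun x => - Real.log x
  have hψ : Measurable ψ := by
    exact (Real.measurable_log.comp measurable_subtype_coe).neg
  have hwm : Measurable (fun x : unitInterval => ENNReal.ofReal ((x : ℝ) ^ ε)) :=
    (continuous_mom ε hε.le).measurable.ennreal_ofReal
  let ρ : Measure unitInterval :=
    (ν : Measure unitInterval).withDensity (fun x => ENNReal.ofReal ((x : ℝ) ^ ε))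
  have : IsFiniteMeasure ρ :=
    isFiniteMeasure_withDensity_ofReal (integrable_mom ν ε hε.le).2
  refine ⟨ρ.map ψ, inferInstance, ?_, fun l hl => ?_⟩
  · rw [Measure.map_apply hψ measurableSet_Iio]
    convert measure_empty (μ := ρ)
    ext x
    simp only [ψ, Set.mem_preimage, Set.mem_Iio, Set.mem_empty_iff_false, iff_false, not_lt]
    have := Real.log_nonpos x.2.1 x.2.2
    linarith
  · have : ∫ t, (Real.exp (-l * t) : ℂ) ∂(ρ.map ψ) = ((∫ t, Real.exp (-l * t) ∂(ρ.map ψ) : ℝ) : ℂ) :=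
      integral_ofReal
    rw [this]
    simp only
    rw [hν (l + ε) (by linarith)]
    congr 1
    rw [integral_map hψ.aemeasurable (by fun_prop)]
    simp only [ρ]
    rw [integral_withDensity_eq_integral_toReal_smul hwm (by simp)]
    apply integral_congr_ae
    refine ae_of_all _ fun x => ?_
    simp only [ψ, smul_eq_mul]
    rw [ENNReal.toReal_ofReal (Real.rpow_nonneg x.2.1 _)]
    rcases x.2.1.eq_or_lt with hx | hx
    · rw [← hx, Real.zero_rpow (by linarith), Real.zero_rpow hε.ne', zero_mul]
    · rw [Real.rpow_add hx, mul_comm, Real.rpow_def_of_pos hx l]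
      ring_nf

lemma choose_nonneg_aux (p : ℝ) (hp : 0 < p) (j : ℕ) : 0 ≤ Ring.choose (p + j - 1) j := by
  have h := Ring.factorial_nsmul_multichoose_eq_ascPochhammer p j
  have h2 : Ring.choose (p + j - 1) j = Ring.multichoose p j := by
    rw [Ring.choose]; congr 1; ring
  have h3 : 0 < (ascPochhammer ℝ j).eval p := ascPochhammer_pos j p hp
  rw [Polynomial.ascPochhammer_smeval_eq_eval, nsmul_eq_mul] at h
  rw [h2]
  rw [← h] at h3
  exact (pos_of_mul_pos_right h3 (by positivity)).le

lemma binom_aux (p y : ℝ) (h0 : 0 ≤ y) (h1 : y < 1) :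
    HasSum (fun j : ℕ => Ring.choose (p + j - 1) j * y ^ j) ((1 - y) ^ (-p)) := by
  have h := (Real.one_div_one_sub_rpow_hasFPowerSeriesOnBall_zero p).hasSum (y := y) (by
    simp [abs_of_nonneg h0, enorm_eq_nnnorm, ← NNReal.coe_lt_coe, h1])
  rw [zero_add] at h
  rw [Real.rpow_neg (by linarith), ← one_div]
  convert! h using 2 with j
  simp [mul_comm]

lemma core {n : ℕ} (x : ℝ → Fin n → ℝ) (hx : ∀ l, 0 ≤ l → ∀ i, 0 < x l i)
    (h : ∀ s : ℝ, 0 ≤ s → ∀ k : ℕ, 0 < k → IsMom (fun l => ∑ i, ((x l i + s)⁻¹) ^ k))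
    (p : ℝ) (hp : 0 < p) : IsMom (fun l => ∑ i, (x l i) ^ (-p)) := by
  have step1 : ∀ s : ℝ, 0 < s → IsMom (fun l => ∑ i, (s / (x l i + s)) ^ (1 - p) * (x l i) ^ (-p)) := by
    intro s hs
    refine isMom_lim (fun N l => ∑ j ∈ Finset.range N,
      (s ^ (-p) * Ring.choose (p + j - 1) j * s ^ (j + 1)) * ∑ i, ((x l i + s)⁻¹) ^ (j + 1)) _ ?_ ?_
    · intro N
      refine isMom_sum _ _ fun j _ => ?_
      refine isMom_smul (h s hs.le (j + 1) (Nat.succ_pos j)) _ ?_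
      have := choose_nonneg_aux p hp j
      positivity
    · intro l hl
      simp only [Finset.mul_sum]
      simp_rw [Finset.sum_comm (s := Finset.range _)]
      refine tendsto_finsetSum _ fun i _ => ?_
      have hxi := hx l hl i
      set X := x l i
      have hy1 : s / (X + s) < 1 := by rw [div_lt_one (by positivity)]; linarith
      have hy0 : 0 < s / (X + s) := by positivity
      have hb := ((binom_aux p _ hy0.le hy1).mul_left (s ^ (-p) * (s / (X + s)))).tendsto_sum_nat
      have e : 1 - s / (X + s) = X * s⁻¹ * (s / (X + s)) := by field_simp; ring
      convert hb using 2
      · refine Finset.sum_congr rfl fun j _ => ?_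
        rw [div_eq_mul_inv]
        ring
      · rw [e, Real.mul_rpow (by positivity) hy0.le, Real.mul_rpow hxi.le (by positivity),
          Real.inv_rpow hs.le, sub_eq_add_neg, Real.rpow_add hy0, Real.rpow_one]
        have : s ^ (-p) ≠ 0 := (Real.rpow_pos_of_pos hs _).ne'
        field_simp
  refine isMom_lim (fun N l => ∑ i, (((N : ℝ) + 1) / (x l i + ((N : ℝ) + 1))) ^ (1 - p) * (x l i) ^ (-p)) _
    (fun N => step1 _ (by positivity)) ?_
  intro l hl
  refine tendsto_finsetSum _ fun i _ => ?_
  have hxi := hx l hl i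
  set X := x l i
  have t1 : Tendsto (fun N : ℕ => ((N : ℝ) + 1) / (X + ((N : ℝ) + 1))) atTop (𝓝 1) := by
    have t2 : Tendsto (fun N : ℕ => X + ((N : ℝ) + 1)) atTop atTop :=
      tendsto_atTop_add_const_left _ _ (tendsto_atTop_add_const_right _ _ tendsto_natCast_atTop_atTop)
    have t3 : Tendsto (fun N : ℕ => 1 - X / (X + ((N : ℝ) + 1))) atTop (𝓝 (1 - 0)) :=
      tendsto_const_nhds.sub (tendsto_const_nhds.div_atTop t2)
    rw [sub_zero] at t3
    refine t3.congr fun N => ?_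
    field_simp
    ring
  have t4 := (t1.rpow_const (p := 1 - p) (Or.inl one_ne_zero)).mul_const (X ^ (-p))
  simpa using t4

lemma trace_conj {n : ℕ} (U : Matrix.unitaryGroup (Fin n) ℂ) (d : Fin n → ℂ) :
    ((U : Matrix (Fin n) (Fin n) ℂ) * Matrix.diagonal d * star (U : Matrix (Fin n) (Fin n) ℂ)).trace
      = ∑ i, d i := by
  rw [Matrix.trace_mul_comm, ← mul_assoc, Unitary.coe_star_mul_self, one_mul, Matrix.trace_diagonal]

lemma spectral_data {n : ℕ} (M : Matrix (Fin n) (Fin n) ℂ) (hM : M.PosDef) :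
    ∃ x : Fin n → ℝ, (∀ i, 0 < x i) ∧
      (∀ s : ℝ, 0 ≤ s → ∀ k : ℕ, (((M + s • 1)⁻¹) ^ k).trace = ((∑ i, ((x i + s)⁻¹) ^ k : ℝ) : ℂ)) ∧
      (∀ q : ℝ, (matRpow M q).trace = ((∑ i, (x i) ^ q : ℝ) : ℂ)) := by
  refine ⟨hM.1.eigenvalues, hM.eigenvalues_pos, ?_, ?_⟩
  · intro s hs k
    set U := hM.1.eigenvectorUnitary
    let V : Matrix (Fin n) (Fin n) ℂ := U
    have hVV : star V * V = 1 := Unitary.coe_star_mul_self U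
    have hVV' : V * star V = 1 := Unitary.coe_mul_star_self U
    have hsp : M = V * Matrix.diagonal (fun i => (hM.1.eigenvalues i : ℂ)) * star V := by
      have := hM.1.spectral_theorem
      rw [Unitary.conjStarAlgAut_apply] at this
      exact this
    have hmul : ∀ d e : Fin n → ℂ, (V * Matrix.diagonal d * star V) * (V * Matrix.diagonal e * star V)
        = V * Matrix.diagonal (fun i => d i * e i) * star V := by
      intro d e
      calc _ = V * Matrix.diagonal d * (star V * V) * Matrix.diagonal e * star V := by
            simp only [mul_assoc]
        _ = _ := by rw [hVV, mul_one, mul_assoc V, Matrix.diagonal_mul_diagonal]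
    have hone : V * Matrix.diagonal (fun _ => (1 : ℂ)) * star V = 1 := by
      rw [Matrix.diagonal_one, mul_one, hVV']
    have hadd : M + s • 1 = V * Matrix.diagonal (fun i => ((hM.1.eigenvalues i + s : ℝ) : ℂ)) * star V := by
      have h1 : (s • 1 : Matrix (Fin n) (Fin n) ℂ) = V * Matrix.diagonal (fun _ => (s : ℂ)) * star V := by
        have : Matrix.diagonal (fun _ : Fin n => (s : ℂ)) = s • (1 : Matrix (Fin n) (Fin n) ℂ) := by
          ext i j; by_cases hij : i = j <;> simp [hij]
        rw [this, mul_smul_comm, mul_one, smul_mul_assoc, hVV']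
      conv_lhs => rw [h1, hsp]
      rw [← add_mul, ← mul_add, Matrix.diagonal_add]
      simp
    have hinv : (M + s • 1)⁻¹ =
        V * Matrix.diagonal (fun i => (((hM.1.eigenvalues i + s)⁻¹ : ℝ) : ℂ)) * star V := by
      apply Matrix.inv_eq_right_inv
      rw [hadd, hmul, ← hone]
      congr 3
      ext i
      have := hM.eigenvalues_pos i
      rw [← Complex.ofReal_mul, mul_inv_cancel₀ (by positivity), Complex.ofReal_one]
    have hpow : ∀ k : ℕ, ((M + s • 1)⁻¹) ^ k =
        V * Matrix.diagonal (fun i => ((((hM.1.eigenvalues i + s)⁻¹) ^ k : ℝ) : ℂ)) * star V := by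
      intro k
      induction k with
      | zero => simpa using hone.symm
      | succ k ih =>
        rw [pow_succ, ih, hinv, hmul]
        simp [pow_succ]
    rw [hpow, trace_conj U]
    push_cast
    rfl
  · intro q
    rw [matRpow, dif_pos hM.1, trace_conj]
    push_cast
    rfl

open scoped MatrixOrder Matrix.Norms.L2Operator in
lemma exists_shift {n : ℕ} (a b : Matrix (Fin n) (Fin n) ℂ) (ha : a.PosDef) (hb : b.PosSemidef) :
    ∃ ε : ℝ, 0 < ε ∧ (a - ε • b).PosDef := by
  rcases isEmpty_or_nonempty (Fin n) with hn | hn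
  · exact ⟨1, one_pos, by rwa [Subsingleton.elim (a - (1 : ℝ) • b) a]⟩
  have h1 : ∃ r > 0, algebraMap ℝ (Matrix (Fin n) (Fin n) ℂ) r ≤ a := by
    refine (CFC.exists_pos_algebraMap_le_iff (a := a) ha.1.isSelfAdjoint).2 fun x hx => ?_
    exact (Matrix.isStrictlyPositive_iff_posDef.2 ha).spectrum_pos hx
  obtain ⟨r, hr, hra⟩ := h1
  have h2 : b ≤ algebraMap ℝ (Matrix (Fin n) (Fin n) ℂ) ‖b‖ :=
    IsSelfAdjoint.le_algebraMap_norm_self hb.1.isSelfAdjoint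
  refine ⟨r / (‖b‖ + 1), by positivity, ?_⟩
  set ε := r / (‖b‖ + 1) with hε
  have hεp : 0 < ε := by positivity
  have e1 : (a - algebraMap ℝ (Matrix (Fin n) (Fin n) ℂ) r).PosSemidef := hra
  have e2 : (algebraMap ℝ (Matrix (Fin n) (Fin n) ℂ) ‖b‖ - b).PosSemidef := h2
  have e3 : (ε • (1 : Matrix (Fin n) (Fin n) ℂ)).PosDef := Matrix.PosDef.one.smul hεp
  have e4 := (e3.add_posSemidef e1).add_posSemidef (e2.smul hεp.le)
  convert e4 using 1
  have : r = ε + ε * ‖b‖ := by rw [hε]; field_simp; ring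
  rw [Algebra.algebraMap_eq_smul_one, Algebra.algebraMap_eq_smul_one]
  conv_rhs => rw [this]
  module

theorem nat_pow_laplace_implies_rpow_laplace (n : ℕ) (hn : 0 < n)
    (h : ∀ a b : Matrix (Fin n) (Fin n) ℂ, a.PosDef → b.PosSemidef → ∀ p : ℕ, 0 < p →
      IsLaplaceTransform fun l : ℝ => (((a + l • b)⁻¹) ^ p).trace) :
    ∀ a b : Matrix (Fin n) (Fin n) ℂ, a.PosDef → b.PosSemidef → ∀ p : ℝ, 0 < p →
      IsLaplaceTransform fun l : ℝ => (matRpow (a + l • b) (-p)).trace := by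
  intro a b ha hb p hp
  obtain ⟨ε, hε, hc⟩ := exists_shift a b ha hb
  set c := a - ε • b with hcdef
  have hM : ∀ l : ℝ, 0 ≤ l → (c + l • b).PosDef := fun l hl => hc.add_posSemidef (hb.smul hl)
  have hd : ∀ l : ℝ, ∃ x : Fin n → ℝ, 0 ≤ l → (∀ i, 0 < x i) ∧
      (∀ s : ℝ, 0 ≤ s → ∀ k : ℕ, (((c + l • b + s • 1)⁻¹) ^ k).trace
        = ((∑ i, ((x i + s)⁻¹) ^ k : ℝ) : ℂ)) ∧
      (∀ q : ℝ, (matRpow (c + l • b) q).trace = ((∑ i, (x i) ^ q : ℝ) : ℂ)) := by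
    intro l
    by_cases hl : 0 ≤ l
    · obtain ⟨x, hx⟩ := spectral_data _ (hM l hl)
      exact ⟨x, fun _ => hx⟩
    · exact ⟨0, fun hl' => absurd hl' hl⟩
  choose x hx using hd
  have hmom : IsMom (fun l => ∑ i, (x l i) ^ (-p)) := by
    refine core x (fun l hl => (hx l hl).1) (fun s hs k hk => ?_) p hp
    have hcs : (c + s • (1 : Matrix (Fin n) (Fin n) ℂ)).PosDef :=
      hc.add_posSemidef (Matrix.PosSemidef.one.smul hs)
    obtain ⟨g, hg, hgl⟩ := isMom_of_laplace (h _ b hcs hb k hk)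
    refine isMom_congr hg fun l hl => ?_
    have h1 := hgl l hl
    have h2 := (hx l hl).2.1 s hs k
    rw [add_right_comm] at h1
    rw [h1] at h2
    exact_mod_cast h2.symm
  obtain ⟨μ, h1, h2, h3⟩ := laplace_of_isMom hmom ε hε
  refine ⟨μ, h1, h2, fun l hl => ?_⟩
  rw [← h3 l hl]
  have h4 := (hx (l + ε) (by linarith)).2.2 (-p)
  simp only
  rw [← h4]
  congr 2
  rw [hcdef]
  module
end
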